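/- For every 0 < r < 1 one has A_1(0) = 24r²/(1 − r)² and A_1(π) = 24r²/(1 + r)². -/

import Mathlib

open Real Filter

/-- The reflection map of the unit circle with light source at `(r,0)`. -/
noncomputable def R (r : ℝ) (φ : ℝ) : ℝ :=
  φ + π - 2 * arctan (r * sin φ / (1 - r * cos φ))

/-- The angle `φ_c ∈ (0,π)` with `cos φ_c = (1 − √(1+8r²))/(4r)`. -/
noncomputable def φc (r : ℝ) : ℝ :=
  arccos ((1 - Real.sqrt (1 + 8 * r ^ 2)) / (4 * r))

/-- `x`-coordinate of the caustic of `R_r^n`. -/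
noncomputable def xc (r : ℝ) (n : ℕ) (φ : ℝ) : ℝ :=
  (deriv ((R r)^[n]) φ * cos φ + cos ((R r)^[n] φ)) / (1 + deriv ((R r)^[n]) φ)

/-- `y`-coordinate of the caustic of `R_r^n`. -/
noncomputable def yc (r : ℝ) (n : ℕ) (φ : ℝ) : ℝ :=
  (deriv ((R r)^[n]) φ * sin φ + sin ((R r)^[n] φ)) / (1 + deriv ((R r)^[n]) φ)

/-- The quantity `A_n(φ) = −(R_r^n)'(φ) + ((R_r^n)'(φ))³ + 2 (R_r^n)'''(φ)`. -/
noncomputable def A (r : ℝ) (n : ℕ) (φ : ℝ) : ℝ :=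
  -(deriv ((R r)^[n]) φ) + (deriv ((R r)^[n]) φ) ^ 3 + 2 * iteratedDeriv 3 ((R r)^[n]) φ

theorem one_sub_two_mul_cos_add_sq_pos {r : ℝ} (hr : 0 < r) (hr1 : r < 1) (φ : ℝ) :
    0 < 1 - 2 * r * cos φ + r ^ 2 := by
  nlinarith [mul_nonneg hr.le (sub_nonneg.2 (cos_le_one φ)), pow_pos (sub_pos.2 hr1) 2]

theorem one_sub_mul_cos_pos {r : ℝ} (hr : 0 < r) (hr1 : r < 1) (φ : ℝ) :
    0 < 1 - r * cos φ := by
  nlinarith [mul_nonneg hr.le (sub_nonneg.2 (cos_le_one φ))]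

theorem hasDerivAt_R {r : ℝ} (hr : 0 < r) (hr1 : r < 1) (φ : ℝ) :
    HasDerivAt (R r) (2 - (1 - r ^ 2) / (1 - 2 * r * cos φ + r ^ 2)) φ := by
  have hD := (one_sub_two_mul_cos_add_sq_pos hr hr1 φ).ne'
  have hE := (one_sub_mul_cos_pos hr hr1 φ).ne'
  have hsum : (1 - r * cos φ) ^ 2 + (r * sin φ) ^ 2 = 1 - 2 * r * cos φ + r ^ 2 := by
    linear_combination r ^ 2 * sin_sq_add_cos_sq φ
  have hsq : 1 + (r * sin φ / (1 - r * cos φ)) ^ 2 =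
      (1 - 2 * r * cos φ + r ^ 2) / (1 - r * cos φ) ^ 2 := by
    rw [← hsum]; field_simp
  have h := ((hasDerivAt_id φ).add_const π).sub
    ((((hasDerivAt_sin φ).const_mul r).div
      (((hasDerivAt_cos φ).const_mul r).const_sub 1) hE).arctan.const_mul 2)
  refine h.congr_deriv ?_
  simp only [Pi.div_apply]
  rw [hsq]
  field_simp
  linear_combination (2 * r ^ 2) * sin_sq_add_cos_sq φ

theorem hasDerivAt_one_sub_two_mul_cos_add_sq (r φ : ℝ) :
    HasDerivAt (fun x => 1 - 2 * r * cos x + r ^ 2) (2 * r * sin φ) φ := by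
  refine ((((hasDerivAt_cos φ).const_mul (2 * r)).const_sub 1).add_const (r ^ 2)).congr_deriv ?_
  ring

theorem deriv_R {r : ℝ} (hr : 0 < r) (hr1 : r < 1) :
    deriv (R r) = fun φ => 2 - (1 - r ^ 2) / (1 - 2 * r * cos φ + r ^ 2) :=
  funext fun φ => (hasDerivAt_R hr hr1 φ).deriv

theorem deriv_deriv_R {r : ℝ} (hr : 0 < r) (hr1 : r < 1) :
    deriv (deriv (R r)) =
      fun φ => (1 - r ^ 2) * (2 * r * sin φ) / (1 - 2 * r * cos φ + r ^ 2) ^ 2 := by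
  rw [deriv_R hr hr1]
  funext φ
  have hD := (one_sub_two_mul_cos_add_sq_pos hr hr1 φ).ne'
  refine ((((hasDerivAt_const φ (1 - r ^ 2)).div
    (hasDerivAt_one_sub_two_mul_cos_add_sq r φ) hD).const_sub 2).congr_deriv ?_).deriv
  ring

theorem iteratedDeriv_three_R {r : ℝ} (hr : 0 < r) (hr1 : r < 1) (φ : ℝ) :
    iteratedDeriv 3 (R r) φ =
      (1 - r ^ 2) * (2 * r * cos φ / (1 - 2 * r * cos φ + r ^ 2) ^ 2 -
        8 * r ^ 2 * sin φ ^ 2 / (1 - 2 * r * cos φ + r ^ 2) ^ 3) := by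
  have hD := (one_sub_two_mul_cos_add_sq_pos hr hr1 φ).ne'
  rw [iteratedDeriv_succ, iteratedDeriv_succ, iteratedDeriv_one, deriv_deriv_R hr hr1]
  refine (((((hasDerivAt_sin φ).const_mul (2 * r)).const_mul (1 - r ^ 2)).div
    ((hasDerivAt_one_sub_two_mul_cos_add_sq r φ).pow 2) (pow_ne_zero 2 hD)).congr_deriv ?_).deriv
  simp only [Pi.pow_apply]
  generalize 1 - 2 * r * cos φ + r ^ 2 = D at hD ⊢
  field_simp
  ring

theorem stmt_7 (r : ℝ) (hr : 0 < r) (hr1 : r < 1) :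
    A r 1 0 = 24 * r ^ 2 / (1 - r) ^ 2 ∧
    A r 1 π = 24 * r ^ 2 / (1 + r) ^ 2 := by
  have h0 : 1 - r ≠ 0 := (sub_pos.2 hr1).ne'
  have h1 : 1 + r ≠ 0 := (add_pos one_pos hr).ne'
  have e0 : 1 - 2 * r * 1 + r ^ 2 = (1 - r) ^ 2 := by ring
  have e1 : 1 - 2 * r * -1 + r ^ 2 = (1 + r) ^ 2 := by ring
  simp only [A, Function.iterate_one, iteratedDeriv_three_R hr hr1, deriv_R hr hr1,
    cos_zero, sin_zero, cos_pi, sin_pi, e0, e1]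
  constructor
  · field_simp
    ring
  · field_simp
    ring
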